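/- arXiv:2101.08954 — 9 statements merged into one kernel-verified Lean document; each statement's English description precedes it below -/
import Mathlib

section
/- Under (L,ε)-local separability, suppose w* ∈ S_K maximizes elpd over S_K, that w*_k > 0 for every k, and that μ(J_k) > 0 for every k. Then 0 ≤ elpd(w*) − elpd(w^approx) ≤ ( ∑_{k=1}^K [ (1−μ(J_k))/μ(J_k) + (1−w*_k)/w*_k ] ) · (ε + e^{−L}). In particular, the weight vector w^approx whose k-th entry is the probability μ(J_k) of model k being the locally best fit is nearly optimal for the stacking objective. -/
open MeasureTheory Real


lemma hs_integrable {Ω : Type*} [MeasurableSpace Ω] (μ : Measure Ω)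
    (K : ℕ) (p : Fin K → Ω → ℝ)
    (hmeas : ∀ k, Measurable (p k))
    (hpos : ∀ k ω, 0 < p k ω)
    (hint : ∀ k, Integrable (fun ω => Real.log (p k ω)) μ)
    (v : Fin K → ℝ) (hv0 : ∀ k, 0 ≤ v k) (hv1 : ∑ k, v k = 1) :
    Integrable (fun ω => Real.log (∑ k, v k * p k ω)) μ := by
  have hS : Integrable (fun ω => ∑ k, |Real.log (p k ω)|) μ :=
    integrable_finsetSum _ (fun k _ => (hint k).abs)
  refine hS.mono' ?_ ?_
  · exact (Real.measurable_log.comp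
      (Finset.measurable_fun_sum _ (fun k _ => (hmeas k).const_mul (v k)))).aestronglyMeasurable
  · refine Filter.Eventually.of_forall (fun ω => ?_)
    rw [Real.norm_eq_abs]
    set S := ∑ k, |Real.log (p k ω)| with hSdef
    have hle : ∀ k, |Real.log (p k ω)| ≤ S := fun k =>
      Finset.single_le_sum (f := fun k => |Real.log (p k ω)|) (fun i _ => abs_nonneg _)
        (Finset.mem_univ k)
    have hup : ∑ k, v k * p k ω ≤ Real.exp S := by
      calc ∑ k, v k * p k ω ≤ ∑ k, v k * Real.exp S := by
            refine Finset.sum_le_sum (fun k _ => mul_le_mul_of_nonneg_left ?_ (hv0 k))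
            rw [← Real.log_le_iff_le_exp (hpos k ω)]
            exact (le_abs_self _).trans (hle k)
        _ = Real.exp S := by rw [← Finset.sum_mul, hv1, one_mul]
    have hlo : Real.exp (-S) ≤ ∑ k, v k * p k ω := by
      calc Real.exp (-S) = ∑ k, v k * Real.exp (-S) := by rw [← Finset.sum_mul, hv1, one_mul]
        _ ≤ _ := by
            refine Finset.sum_le_sum (fun k _ => mul_le_mul_of_nonneg_left ?_ (hv0 k))
            rw [← Real.le_log_iff_exp_le (hpos k ω)]
            have := neg_abs_le (Real.log (p k ω))
            linarith [hle k]
    have hP : 0 < ∑ k, v k * p k ω := (Real.exp_pos _).trans_le hlo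
    rw [abs_le]
    exact ⟨(Real.le_log_iff_exp_le hP).2 hlo, (Real.log_le_iff_le_exp hP).2 hup⟩

/-- pointwise bound -/
lemma hs_pointwise (K : ℕ) (q : Fin K → ℝ) (hq : ∀ k, 0 < q k) (w a : Fin K → ℝ)
    (hw0 : ∀ k, 0 < w k) (hw1 : ∑ k, w k = 1) (ha : ∀ k, 0 < a k) (k : Fin K) (c : ℝ)
    (hc : ∀ k', k' ≠ k → q k' ≤ c * q k) :
    Real.log (∑ k, w k * q k) - Real.log (∑ k, a k * q k) ≤
      Real.log (w k) - Real.log (a k) + (1 - w k) / w k * c := by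
  have h1 : Real.log (a k) + Real.log (q k) ≤ Real.log (∑ k, a k * q k) := by
    rw [← Real.log_mul (ha k).ne' (hq k).ne']
    refine Real.log_le_log (mul_pos (ha k) (hq k)) ?_
    exact Finset.single_le_sum (f := fun k => a k * q k)
      (fun i _ => (mul_pos (ha i) (hq i)).le) (Finset.mem_univ k)
  have hwq := mul_pos (hw0 k) (hq k)
  have hs : ∑ i, w i * q i ≤ w k * q k + (1 - w k) * (c * q k) := by
    rw [← Finset.add_sum_erase _ _ (Finset.mem_univ k)]
    have : 1 - w k = ∑ i ∈ Finset.univ.erase k, w i := by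
      rw [← hw1, ← Finset.add_sum_erase _ _ (Finset.mem_univ k)]; ring
    rw [this, Finset.sum_mul]
    gcongr with i hi
    · exact (hw0 i).le
    · exact hc i (Finset.ne_of_mem_erase hi)
  have hS : 0 < ∑ i, w i * q i :=
    Finset.sum_pos (fun i _ => mul_pos (hw0 i) (hq i)) ⟨k, Finset.mem_univ k⟩
  have h2 : Real.log (∑ i, w i * q i) ≤ Real.log (w k) + Real.log (q k) + (1 - w k) / w k * c := by
    have h3 : Real.log (∑ i, w i * q i) - Real.log (w k * q k)
        ≤ (∑ i, w i * q i) / (w k * q k) - 1 := by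
      rw [← Real.log_div hS.ne' hwq.ne']
      exact Real.log_le_sub_one_of_pos (div_pos hS hwq)
    have h4 : (∑ i, w i * q i) / (w k * q k) ≤ 1 + (1 - w k) / w k * c := by
      rw [div_le_iff₀ hwq]
      refine hs.trans (le_of_eq ?_)
      have := (hw0 k).ne'
      field_simp
    rw [Real.log_mul (hw0 k).ne' (hq k).ne'] at h3
    linarith
  linarith

/-- Under (L,ε)-local separability, if `w` maximizes the stacking
objective `elpd` over the simplex, has all entries positive, and every winning region
has positive probability, then `w^approx` (given by `w^approx_k = μ(J_k)`) is nearly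
optimal:
`0 ≤ elpd(w) − elpd(w^approx) ≤ (∑_k [(1−μ(J_k))/μ(J_k) + (1−w_k)/w_k]) (ε + e^{−L})`. -/
theorem hierarchical_stacking_stmt0
    {Ω : Type*} [MeasurableSpace Ω] (μ : Measure Ω) [IsProbabilityMeasure μ]
    (K : ℕ) (hK : 2 ≤ K)
    (p : Fin K → Ω → ℝ)
    (hmeas : ∀ k, Measurable (p k))
    (hpos : ∀ k ω, 0 < p k ω)
    (hint : ∀ k, Integrable (fun ω => Real.log (p k ω)) μ)
    (J : Fin K → Set Ω)
    (hJ : ∀ k, J k = {ω | (∀ k', p k' ω ≤ p k ω) ∧ ∀ k' < k, p k' ω < p k ω})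
    (L ε : ℝ) (hL : 0 < L) (hε0 : 0 ≤ ε) (hε1 : ε < 1)
    (hsep : ∑ k, (μ {ω ∈ J k | ∃ k', k' ≠ k ∧ p k ω < Real.exp L * p k' ω}).toReal ≤ ε)
    (w : Fin K → ℝ) (hw0 : ∀ k, 0 < w k) (hw1 : ∑ k, w k = 1)
    (hmax : ∀ v : Fin K → ℝ, (∀ k, 0 ≤ v k) → ∑ k, v k = 1 →
      ∫ ω, Real.log (∑ k, v k * p k ω) ∂μ ≤ ∫ ω, Real.log (∑ k, w k * p k ω) ∂μ)
    (hJpos : ∀ k, 0 < (μ (J k)).toReal) :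
    0 ≤ (∫ ω, Real.log (∑ k, w k * p k ω) ∂μ)
        - (∫ ω, Real.log (∑ k, (μ (J k)).toReal * p k ω) ∂μ) ∧
    (∫ ω, Real.log (∑ k, w k * p k ω) ∂μ)
        - (∫ ω, Real.log (∑ k, (μ (J k)).toReal * p k ω) ∂μ)
      ≤ (∑ k, ((1 - (μ (J k)).toReal) / (μ (J k)).toReal + (1 - w k) / w k))
          * (ε + Real.exp (-L)) := by
  have hJm : ∀ k, MeasurableSet (J k) := by
    intro k
    rw [hJ k, Set.ofPred_and]
    refine MeasurableSet.inter ?_ ?_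
    · rw [Set.ofPred_forall]
      exact MeasurableSet.iInter (fun k' => measurableSet_le (hmeas k') (hmeas k))
    · simp only [Set.ofPred_forall]
      exact MeasurableSet.iInter (fun k' => MeasurableSet.iInter
        (fun _ => measurableSet_lt (hmeas k') (hmeas k)))
  set B : Fin K → Set Ω :=
    fun k => {ω ∈ J k | ∃ k', k' ≠ k ∧ p k ω < Real.exp L * p k' ω} with hB
  have hBm : ∀ k, MeasurableSet (B k) := by
    intro k
    have : B k = J k ∩ ⋃ k', ⋃ (_ : k' ≠ k), {ω | p k ω < Real.exp L * p k' ω} := by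
      ext ω; simp [hB]
    rw [this]
    exact (hJm k).inter (MeasurableSet.iUnion (fun k' => MeasurableSet.iUnion
        (fun _ => measurableSet_lt (hmeas k) ((hmeas k').const_mul _))))
  have hBJ : ∀ k ω, ω ∈ B k → ω ∈ J k := fun k ω h => h.1
  have huniq : ∀ ω k k', ω ∈ J k → ω ∈ J k' → k = k' := by
    intro ω k k' h h'
    rw [hJ] at h h'
    rcases lt_trichotomy k k' with hlt | heq | hlt
    · exact absurd (h.1 k') (not_le.2 (h'.2 k hlt))
    · exact heq
    · exact absurd (h'.1 k) (not_le.2 (h.2 k' hlt))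
  have hex : ∀ ω, ∃ k, ω ∈ J k := by
    intro ω
    obtain ⟨m, -, hm⟩ := Finset.exists_max_image (Finset.univ : Finset (Fin K))
      (fun k => p k ω) ⟨⟨0, by omega⟩, Finset.mem_univ _⟩
    obtain ⟨k, hk, hkm⟩ := Finset.exists_min_image
      (Finset.univ.filter (fun k => p m ω ≤ p k ω)) id ⟨m, by simp⟩
    simp only [Finset.mem_filter, Finset.mem_univ, true_and, id] at hk hkm
    refine ⟨k, ?_⟩
    rw [hJ]
    refine ⟨fun k' => (hm k' (Finset.mem_univ _)).trans hk, fun k' hlt => ?_⟩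
    by_contra hcon
    exact absurd (hkm k' (hk.trans (not_lt.1 hcon))) (not_le.2 hlt)
  set a : Fin K → ℝ := fun k => (μ (J k)).toReal with ha
  have hapos : ∀ k, 0 < a k := hJpos
  have hsumind : ∀ (c : Fin K → ℝ) ω k, ω ∈ J k →
      ∑ i, (J i).indicator (fun _ => c i) ω = c k := by
    intro c ω k hk
    rw [Finset.sum_eq_single k]
    · simp [hk]
    · intro i _ hik
      exact Set.indicator_of_notMem (fun h => hik (huniq ω i k h hk)) _
    · simp
  have hiJ : ∀ (c : ℝ) k, Integrable ((J k).indicator (fun _ => c)) μ :=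
    fun c k => (integrable_const c).indicator (hJm k)
  have hiB : ∀ (c : ℝ) k, Integrable ((B k).indicator (fun _ => c)) μ :=
    fun c k => (integrable_const c).indicator (hBm k)
  have hIJ : ∀ (c : ℝ) k, ∫ ω, (J k).indicator (fun _ => c) ω ∂μ = a k * c := by
    intro c k
    rw [integral_indicator_const c (hJm k)]; rfl
  have hIB : ∀ (c : ℝ) k, ∫ ω, (B k).indicator (fun _ => c) ω ∂μ = (μ (B k)).toReal * c := by
    intro c k
    rw [integral_indicator_const c (hBm k)]; rfl
  have ha1 : ∑ k, a k = 1 := by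
    have h : ∫ ω, ∑ i, (J i).indicator (fun _ => (1 : ℝ)) ω ∂μ = ∫ ω, (1 : ℝ) ∂μ := by
      congr 1
      ext ω
      obtain ⟨k, hk⟩ := hex ω
      exact hsumind (fun _ => 1) ω k hk
    rw [integral_finsetSum _ (fun k _ => hiJ 1 k)] at h
    simpa [hIJ] using h
  have hIw := hs_integrable μ K p hmeas hpos hint w (fun k => (hw0 k).le) hw1
  have hIa := hs_integrable μ K p hmeas hpos hint a (fun k => (hapos k).le) ha1
  have hwle : ∀ k, w k ≤ 1 := fun k => hw1 ▸
    Finset.single_le_sum (f := w) (fun i _ => (hw0 i).le) (Finset.mem_univ k)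
  have hale : ∀ k, a k ≤ 1 := fun k => ha1 ▸
    Finset.single_le_sum (f := a) (fun i _ => (hapos i).le) (Finset.mem_univ k)
  refine ⟨sub_nonneg.2 (hmax a (fun k => (hapos k).le) ha1), ?_⟩
  set r : Fin K → ℝ := fun k => (1 - w k) / w k with hr
  have hr0 : ∀ k, 0 ≤ r k := fun k => div_nonneg (by linarith [hwle k]) (hw0 k).le
  set d : Fin K → ℝ := fun k => Real.log (w k) - Real.log (a k) + r k * Real.exp (-L) with hd
  have hpt : ∀ ω, Real.log (∑ k, w k * p k ω) - Real.log (∑ k, a k * p k ω) ≤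
      ∑ k, ((J k).indicator (fun _ => d k) ω + (B k).indicator (fun _ => r k) ω) := by
    intro ω
    obtain ⟨k, hk⟩ := hex ω
    rw [Finset.sum_add_distrib, hsumind d ω k hk]
    have hBs : (B k).indicator (fun _ => r k) ω ≤ ∑ i, (B i).indicator (fun _ => r i) ω :=
      Finset.single_le_sum (f := fun i => (B i).indicator (fun _ => r i) ω)
        (fun i _ => Set.indicator_nonneg (fun _ _ => hr0 i) ω) (Finset.mem_univ k)
    by_cases hb : ω ∈ B k
    · rw [Set.indicator_of_mem hb] at hBs
      have hk' := hk
      rw [hJ] at hk'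
      have := hs_pointwise K (fun k => p k ω) (fun k => hpos k ω) w a hw0 hw1 hapos k 1
        (fun k' _ => by simpa using hk'.1 k')
      have h2 : 0 ≤ r k * Real.exp (-L) := mul_nonneg (hr0 k) (Real.exp_pos _).le
      simp only [hd, hr] at *
      linarith
    · rw [Set.indicator_of_notMem hb] at hBs
      have := hs_pointwise K (fun k => p k ω) (fun k => hpos k ω) w a hw0 hw1 hapos k
        (Real.exp (-L)) (fun k' hne => by
          have h3 : Real.exp L * p k' ω ≤ p k ω := by
            by_contra hcon
            exact hb ⟨hk, k', hne, not_le.1 hcon⟩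
          rw [Real.exp_neg, le_inv_mul_iff₀ (Real.exp_pos L)]
          exact h3)
      simp only [hd, hr] at *
      linarith
  have hmain : (∫ ω, Real.log (∑ k, w k * p k ω) ∂μ) - (∫ ω, Real.log (∑ k, a k * p k ω) ∂μ)
      ≤ ∑ k, (a k * d k + (μ (B k)).toReal * r k) := by
    rw [← integral_sub hIw hIa]
    refine (integral_mono (hIw.sub hIa)
      (integrable_finsetSum _ (fun k _ => (hiJ (d k) k).add (hiB (r k) k))) hpt).trans
      (le_of_eq ?_)
    refine (integral_finsetSum _ (fun k _ => (hiJ (d k) k).add (hiB (r k) k))).trans ?_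
    refine Finset.sum_congr rfl (fun k _ => ?_)
    refine (integral_add (hiJ (d k) k) (hiB (r k) k)).trans ?_
    rw [hIJ, hIB]
  refine hmain.trans ?_
  have hterm : ∀ k, a k * d k + (μ (B k)).toReal * r k ≤
      (w k - a k) + ((1 - a k) / a k + r k) * (ε + Real.exp (-L)) := by
    intro k
    have hBε : (μ (B k)).toReal ≤ ε :=
      (Finset.single_le_sum (f := fun k => (μ (B k)).toReal)
        (fun i _ => ENNReal.toReal_nonneg) (Finset.mem_univ k)).trans hsep
    have hlog : a k * (Real.log (w k) - Real.log (a k)) ≤ w k - a k := by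
      rw [← Real.log_div (hw0 k).ne' (hapos k).ne']
      have h := Real.log_le_sub_one_of_pos (div_pos (hw0 k) (hapos k))
      have h' := mul_le_mul_of_nonneg_left h (hapos k).le
      refine h'.trans (le_of_eq ?_)
      have := (hapos k).ne'
      field_simp
    have he := Real.exp_pos (-L)
    have h1 : 0 ≤ (1 - a k) / a k * (ε + Real.exp (-L)) :=
      mul_nonneg (div_nonneg (by linarith [hale k]) (hapos k).le) (by linarith)
    have h2 := mul_le_mul_of_nonneg_right hBε (hr0 k)
    have h3 := mul_le_mul_of_nonneg_right (hale k) (mul_nonneg (hr0 k) he.le)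
    simp only [hd]
    linarith
  refine (Finset.sum_le_sum (fun k _ => hterm k)).trans (le_of_eq ?_)
  rw [Finset.sum_add_distrib, Finset.sum_sub_distrib, hw1, ha1, ← Finset.sum_mul]
  rw [sub_self, zero_add]
end

section
/- Under (L,ε)-local separability, for every w ∈ S_K with w_k > 0 for all k, the stacking objective is uniformly close to its surrogate: |elpd(w) − elpd_s(w)| ≤ ( ∑_{k=1}^K (1−w_k)/w_k ) · (ε + e^{−L}). -/
open MeasureTheory Real

/-- Under (L,ε)-local separability, for every weight vector `w` in the
simplex with all entries positive, the stacking objective `elpd` is uniformly close to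
its surrogate `elpd_s`:
`|elpd(w) − elpd_s(w)| ≤ (∑_k (1−w_k)/w_k) (ε + e^{−L})`. -/
theorem hierarchical_stacking_stmt1
    {Ω : Type*} [MeasurableSpace Ω] (μ : Measure Ω) [IsProbabilityMeasure μ]
    (K : ℕ) (hK : 2 ≤ K)
    (p : Fin K → Ω → ℝ)
    (hmeas : ∀ k, Measurable (p k))
    (hpos : ∀ k ω, 0 < p k ω)
    (hint : ∀ k, Integrable (fun ω => Real.log (p k ω)) μ)
    (J : Fin K → Set Ω)
    (hJ : ∀ k, J k = {ω | (∀ k', p k' ω ≤ p k ω) ∧ ∀ k' < k, p k' ω < p k ω})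
    (L ε : ℝ) (hL : 0 < L) (hε0 : 0 ≤ ε) (hε1 : ε < 1)
    (hsep : ∑ k, (μ {ω ∈ J k | ∃ k', k' ≠ k ∧ p k ω < Real.exp L * p k' ω}).toReal ≤ ε)
    (w : Fin K → ℝ) (hw0 : ∀ k, 0 < w k) (hw1 : ∑ k, w k = 1) :
    |(∫ ω, Real.log (∑ k, w k * p k ω) ∂μ)
        - ∑ k, ∫ ω in J k, Real.log (w k * p k ω) ∂μ|
      ≤ (∑ k, (1 - w k) / w k) * (ε + Real.exp (-L)) := by
  have hKne : Nonempty (Fin K) := ⟨⟨0, by omega⟩⟩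
  have hJm : ∀ k, MeasurableSet (J k) := by
    intro k
    rw [hJ k]
    have h1 : MeasurableSet {ω | ∀ k', p k' ω ≤ p k ω} := by
      rw [Set.setOf_forall]
      exact MeasurableSet.iInter fun k' => measurableSet_le (hmeas k') (hmeas k)
    have h2 : MeasurableSet {ω | ∀ k' < k, p k' ω < p k ω} := by
      simp only [Set.setOf_forall]
      exact MeasurableSet.iInter fun k' => MeasurableSet.iInter fun _ =>
        measurableSet_lt (hmeas k') (hmeas k)
    exact h1.inter h2
  have hdisj : Pairwise (Function.onFun Disjoint J) := by
    intro a b hab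
    rw [Function.onFun, Set.disjoint_left]
    intro ω ha hb
    rw [hJ a] at ha
    rw [hJ b] at hb
    rcases lt_or_gt_of_ne hab with h | h
    · exact absurd (hb.2 a h) (not_lt.2 (ha.1 b))
    · exact absurd (ha.2 b h) (not_lt.2 (hb.1 a))
  have hcov : (⋃ k, J k) = Set.univ := by
    rw [Set.eq_univ_iff_forall]
    intro ω
    obtain ⟨m, hm⟩ := Finite.exists_max (fun k => p k ω)
    obtain ⟨k, hk, hkmin⟩ := WellFounded.has_min (wellFounded_lt (α := Fin K))
      {k | ∀ k', p k' ω ≤ p k ω} ⟨m, hm⟩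
    refine Set.mem_iUnion.2 ⟨k, ?_⟩
    rw [hJ k]
    refine ⟨hk, fun k' hk' => ?_⟩
    by_contra hcon
    exact hkmin k' (fun j => (hk j).trans (not_lt.1 hcon)) hk'
  have hSpos : ∀ ω, 0 < ∑ k, w k * p k ω := fun ω =>
    Finset.sum_pos (fun k _ => mul_pos (hw0 k) (hpos k ω)) Finset.univ_nonempty
  have hSint : Integrable (fun ω => Real.log (∑ k, w k * p k ω)) μ := by
    have hb : Integrable (fun ω => ∑ k, |Real.log (p k ω)|) μ :=
      integrable_finsetSum _ fun k _ => (hint k).abs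
    refine hb.mono' ?_ (Filter.Eventually.of_forall fun ω => ?_)
    · exact (Real.measurable_log.comp
        (Finset.measurable_sum _ fun k _ => (hmeas k).const_mul (w k))).aestronglyMeasurable
    · have hs : ∀ k, |Real.log (p k ω)| ≤ ∑ k, |Real.log (p k ω)| := fun k =>
        Finset.single_le_sum (f := fun k => |Real.log (p k ω)|)
          (fun _ _ => abs_nonneg _) (Finset.mem_univ k)
      obtain ⟨m, hm⟩ := Finite.exists_max (fun k => p k ω)
      obtain ⟨n, hn⟩ := Finite.exists_min (fun k => p k ω)
      have hup : ∑ k, w k * p k ω ≤ p m ω := by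
        calc ∑ k, w k * p k ω ≤ ∑ k, w k * p m ω :=
              Finset.sum_le_sum fun k _ => mul_le_mul_of_nonneg_left (hm k) (hw0 k).le
          _ = p m ω := by rw [← Finset.sum_mul, hw1, one_mul]
      have hlo : p n ω ≤ ∑ k, w k * p k ω := by
        calc p n ω = ∑ k, w k * p n ω := by rw [← Finset.sum_mul, hw1, one_mul]
          _ ≤ _ := Finset.sum_le_sum fun k _ => mul_le_mul_of_nonneg_left (hn k) (hw0 k).le
      rw [Real.norm_eq_abs, abs_le]
      have h1 := Real.log_le_log (hSpos ω) hup
      have h2 := Real.log_le_log (hpos n ω) hlo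
      constructor
      · linarith [hs n, neg_abs_le (Real.log (p n ω))]
      · linarith [hs m, le_abs_self (Real.log (p m ω))]
  have hkint : ∀ k, Integrable (fun ω => Real.log (w k * p k ω)) μ := by
    intro k
    have : (fun ω => Real.log (w k * p k ω)) = fun ω => Real.log (w k) + Real.log (p k ω) := by
      funext ω
      exact Real.log_mul (hw0 k).ne' (hpos k ω).ne'
    rw [this]
    exact (integrable_const _).add (hint k)
  have hsplit : ∫ ω, Real.log (∑ k, w k * p k ω) ∂μ
      = ∑ k, ∫ ω in J k, Real.log (∑ k, w k * p k ω) ∂μ := by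
    rw [← integral_iUnion_fintype hJm hdisj (fun k => hSint.integrableOn), hcov,
      Measure.restrict_univ]
  rw [hsplit, ← Finset.sum_sub_distrib, Finset.sum_mul]
  refine (Finset.abs_sum_le_sum_abs _ _).trans (Finset.sum_le_sum fun k _ => ?_)
  rw [← integral_sub hSint.integrableOn (hkint k).integrableOn]
  have hwk : w k ≤ 1 := by
    rw [← hw1]
    exact Finset.single_le_sum (f := w) (fun j _ => (hw0 j).le) (Finset.mem_univ k)
  have hc : 0 ≤ (1 - w k) / w k := div_nonneg (by linarith) (hw0 k).le
  set c := (1 - w k) / w k with hcdef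
  set B := {ω ∈ J k | ∃ k', k' ≠ k ∧ p k ω < Real.exp L * p k' ω} with hB
  have hBm : MeasurableSet B := by
    have h1 : MeasurableSet {ω | ∃ k', k' ≠ k ∧ p k ω < Real.exp L * p k' ω} := by
      simp only [Set.setOf_exists, Set.setOf_and]
      exact MeasurableSet.iUnion fun k' => (MeasurableSet.const _).inter
        (measurableSet_lt (hmeas k) ((hmeas k').const_mul _))
    exact (hJm k).inter h1
  have hBε : μ.real B ≤ ε := le_trans (Finset.single_le_sum
    (f := fun k => (μ {ω ∈ J k | ∃ k', k' ≠ k ∧ p k ω < Real.exp L * p k' ω}).toReal)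
    (fun _ _ => ENNReal.toReal_nonneg) (Finset.mem_univ k)) hsep
  -- pointwise bound through a common ratio
  have key : ∀ ω r, 0 ≤ r → (∀ k', k' ≠ k → p k' ω ≤ r * p k ω) →
      Real.log (∑ k, w k * p k ω) - Real.log (w k * p k ω) ≤ c * r := by
    intro ω r hr h
    have hq : 0 < w k * p k ω := mul_pos (hw0 k) (hpos k ω)
    rw [← Real.log_div (hSpos ω).ne' hq.ne']
    refine (Real.log_le_sub_one_of_pos (div_pos (hSpos ω) hq)).trans ?_
    have hsum : ∑ j ∈ Finset.univ.erase k, w j = 1 - w k := by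
      rw [← hw1, ← Finset.add_sum_erase _ w (Finset.mem_univ k)]; ring
    have h3 : ∑ j, w j * p j ω ≤ w k * p k ω + (1 - w k) * (r * p k ω) := by
      rw [← Finset.add_sum_erase _ (fun j => w j * p j ω) (Finset.mem_univ k), ← hsum,
        Finset.sum_mul]
      gcongr with j hj
      · exact (hw0 j).le
      · exact h j (Finset.ne_of_mem_erase hj)
    rw [sub_le_iff_le_add, div_le_iff₀ hq]
    have h4 : (c * r + 1) * (w k * p k ω) = w k * p k ω + (1 - w k) * (r * p k ω) := by
      have := (hw0 k).ne'
      rw [hcdef]; field_simp; ring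
    rw [h4]; exact h3
  have hnn : ∀ ω, 0 ≤ Real.log (∑ k, w k * p k ω) - Real.log (w k * p k ω) := by
    intro ω
    exact sub_nonneg.2 (Real.log_le_log (mul_pos (hw0 k) (hpos k ω))
      (Finset.single_le_sum (f := fun k => w k * p k ω)
        (fun j _ => (mul_pos (hw0 j) (hpos j ω)).le) (Finset.mem_univ k)))
  rw [abs_of_nonneg (integral_nonneg hnn)]
  have hIi : Integrable (B.indicator (fun _ => (1 : ℝ))) μ :=
    (integrable_const _).indicator hBm
  have hGi : Integrable (fun ω => c * (B.indicator (fun _ => (1 : ℝ)) ω + Real.exp (-L))) μ :=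
    (hIi.add (integrable_const _)).const_mul c
  have hGnn : ∀ ω, 0 ≤ c * (B.indicator (fun _ => (1 : ℝ)) ω + Real.exp (-L)) := fun ω =>
    mul_nonneg hc (add_nonneg (Set.indicator_nonneg (fun _ _ => zero_le_one) ω)
      (Real.exp_pos _).le)
  calc ∫ ω in J k, (Real.log (∑ k, w k * p k ω) - Real.log (w k * p k ω)) ∂μ
      ≤ ∫ ω in J k, c * (B.indicator (fun _ => (1 : ℝ)) ω + Real.exp (-L)) ∂μ := by
        refine setIntegral_mono_on (hSint.sub (hkint k)).integrableOn hGi.integrableOn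
          (hJm k) fun ω hω => ?_
        by_cases hωB : ω ∈ B
        · rw [Set.indicator_of_mem hωB]
          refine (key ω 1 zero_le_one fun k' _ => ?_).trans
            (mul_le_mul_of_nonneg_left (by linarith [Real.exp_pos (-L)]) hc)
          rw [hJ k] at hω
          rw [one_mul]; exact hω.1 k'
        · rw [Set.indicator_of_notMem hωB, zero_add]
          refine key ω _ (Real.exp_pos _).le fun k' hk' => ?_
          have h5 : Real.exp L * p k' ω ≤ p k ω := by
            by_contra hcon
            exact hωB ⟨hω, k', hk', not_le.1 hcon⟩
          calc p k' ω = Real.exp (-L) * (Real.exp L * p k' ω) := by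
                rw [← mul_assoc, ← Real.exp_add]; simp
            _ ≤ _ := mul_le_mul_of_nonneg_left h5 (Real.exp_pos _).le
    _ ≤ ∫ ω, c * (B.indicator (fun _ => (1 : ℝ)) ω + Real.exp (-L)) ∂μ :=
        setIntegral_le_integral hGi (Filter.Eventually.of_forall hGnn)
    _ = c * (μ.real B + Real.exp (-L)) := by
        rw [integral_const_mul, integral_add hIi (integrable_const _),
          integral_indicator hBm]
        simp
    _ ≤ c * (ε + Real.exp (-L)) := by gcongr
end

section
/- Under (L,ε)-local separability, suppose μ(J_k) > 0 for every k and let ρ = max_k μ(J_k). Then for every index k, the surrogate objective at w^approx dominates the single-model expected log predictive density: elpd_s(w^approx) − ∫_Ω log p_k dμ ≥ ∑_{l=1}^K μ(J_l) log μ(J_l) + L · max(0, 1 − ρ − ε). -/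
open MeasureTheory Real

/-- Under (L,ε)-local separability, if every winning region has
positive probability and `ρ = max_k μ(J_k)`, then for every index `k`, the surrogate
objective at `w^approx` dominates the single-model expected log predictive density:
`elpd_s(w^approx) − ∫ log p_k dμ ≥ ∑_l μ(J_l) log μ(J_l) + L · max(0, 1 − ρ − ε)`. -/
theorem hierarchical_stacking_stmt5
    {Ω : Type*} [MeasurableSpace Ω] (μ : Measure Ω) [IsProbabilityMeasure μ]
    (K : ℕ) (hK : 2 ≤ K)
    (p : Fin K → Ω → ℝ)
    (hmeas : ∀ k, Measurable (p k))
    (hpos : ∀ k ω, 0 < p k ω)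
    (hint : ∀ k, Integrable (fun ω => Real.log (p k ω)) μ)
    (J : Fin K → Set Ω)
    (hJ : ∀ k, J k = {ω | (∀ k', p k' ω ≤ p k ω) ∧ ∀ k' < k, p k' ω < p k ω})
    (L ε : ℝ) (hL : 0 < L) (hε0 : 0 ≤ ε) (hε1 : ε < 1)
    (hsep : ∑ k, (μ {ω ∈ J k | ∃ k', k' ≠ k ∧ p k ω < Real.exp L * p k' ω}).toReal ≤ ε)
    (hJpos : ∀ k, 0 < (μ (J k)).toReal)
    (ρ : ℝ)
    (hρ : ρ = Finset.univ.sup' ⟨(⟨0, by omega⟩ : Fin K), Finset.mem_univ _⟩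
      fun k => (μ (J k)).toReal)
    (k : Fin K) :
    (∑ l, ∫ ω in J l, Real.log ((μ (J l)).toReal * p l ω) ∂μ)
        - (∫ ω, Real.log (p k ω) ∂μ)
      ≥ (∑ l, (μ (J l)).toReal * Real.log ((μ (J l)).toReal))
        + L * max 0 (1 - ρ - ε) := by
  have hJm : ∀ l, MeasurableSet (J l) := by
    intro l
    rw [hJ l]
    have h1 : MeasurableSet {ω | ∀ k', p k' ω ≤ p l ω} := by
      rw [Set.ofPred_forall]
      exact MeasurableSet.iInter fun k' => measurableSet_le (hmeas k') (hmeas l)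
    have h2 : MeasurableSet {ω | ∀ k' < l, p k' ω < p l ω} := by
      simp only [Set.ofPred_forall]
      exact MeasurableSet.iInter fun k' => MeasurableSet.iInter fun _ =>
        measurableSet_lt (hmeas k') (hmeas l)
    exact h1.inter h2
  have hBm : ∀ l, MeasurableSet {ω ∈ J l | ∃ k', k' ≠ l ∧ p l ω < Real.exp L * p k' ω} := by
    intro l
    have : {ω | ∃ k', k' ≠ l ∧ p l ω < Real.exp L * p k' ω}
        = ⋃ k', ⋃ (_ : k' ≠ l), {ω | p l ω < Real.exp L * p k' ω} := by
      ext ω; simp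
    refine (hJm l).inter (s₂ := {ω | ∃ k', k' ≠ l ∧ p l ω < Real.exp L * p k' ω}) ?_
    rw [this]
    exact MeasurableSet.iUnion fun k' => MeasurableSet.iUnion fun _ =>
        measurableSet_lt (hmeas l) ((hmeas k').const_mul _)
  have hdisj : Pairwise (Function.onFun Disjoint J) := by
    intro a b hab
    rw [Function.onFun, Set.disjoint_left]
    intro ω ha hb
    rw [hJ] at ha hb
    rcases lt_or_gt_of_ne hab with h | h
    · exact absurd (ha.1 b) (not_le.2 (hb.2 a h))
    · exact absurd (hb.1 a) (not_le.2 (ha.2 b h))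
  have hcov : ⋃ l, J l = Set.univ := by
    rw [Set.eq_univ_iff_forall]
    intro ω
    have : Nonempty (Fin K) := ⟨k⟩
    have hex : ∃ l, ∀ k', p k' ω ≤ p l ω := Finite.exists_max (fun l => p l ω)
    classical
    let S : Finset (Fin K) := Finset.univ.filter fun l => ∀ k', p k' ω ≤ p l ω
    have hS : S.Nonempty := by
      obtain ⟨l, hl⟩ := hex
      exact ⟨l, by simp [S]; exact hl⟩
    have hm : ∀ k', p k' ω ≤ p (S.min' hS) ω := by
      have := S.min'_mem hS
      exact (Finset.mem_filter.1 this).2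
    refine Set.mem_iUnion.2 ⟨S.min' hS, ?_⟩
    rw [hJ]
    refine ⟨hm, fun k' hk' => ?_⟩
    by_contra hcon
    push Not at hcon
    have : k' ∈ S := Finset.mem_filter.2 ⟨Finset.mem_univ _, fun k'' => (hm k'').trans hcon⟩
    exact absurd (S.min'_le k' this) (not_le.2 hk')
  have hsplit : ∀ f : Ω → ℝ, Integrable f μ → ∫ ω, f ω ∂μ = ∑ l, ∫ ω in J l, f ω ∂μ := by
    intro f hf
    rw [← integral_iUnion_fintype hJm hdisj (fun l => hf.integrableOn), hcov, setIntegral_univ]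
  have hsum : ∑ l, (μ (J l)).toReal = 1 := by
    have := hsplit (fun _ => 1) (integrable_const _)
    simpa [Measure.real] using this.symm
  have hlog : ∀ l, ∫ ω in J l, Real.log ((μ (J l)).toReal * p l ω) ∂μ
      = (μ (J l)).toReal * Real.log ((μ (J l)).toReal) + ∫ ω in J l, Real.log (p l ω) ∂μ := by
    intro l
    have : ∀ ω, Real.log ((μ (J l)).toReal * p l ω)
        = Real.log ((μ (J l)).toReal) + Real.log (p l ω) := fun ω =>
      Real.log_mul (hJpos l).ne' (hpos l ω).ne'
    simp only [this]
    rw [integral_add (integrable_const _) (hint l).integrableOn]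
    simp [Measure.real]
  have hdiff : ∀ l, Integrable (fun ω => Real.log (p l ω) - Real.log (p k ω)) μ :=
    fun l => (hint l).sub (hint k)
  have hnn : ∀ l, ∀ ω ∈ J l, 0 ≤ Real.log (p l ω) - Real.log (p k ω) := by
    intro l ω hω
    rw [hJ] at hω
    exact sub_nonneg.2 (Real.log_le_log (hpos k ω) (hω.1 k))
  have h0 : ∀ l, 0 ≤ ∫ ω in J l, (Real.log (p l ω) - Real.log (p k ω)) ∂μ := fun l =>
    setIntegral_nonneg (hJm l) (hnn l)
  have h1 : ∀ l, L * ((μ (J l)).toReal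
      - (μ {ω ∈ J l | ∃ k', k' ≠ l ∧ p l ω < Real.exp L * p k' ω}).toReal)
      - (if l = k then L * (μ (J k)).toReal else 0)
      ≤ ∫ ω in J l, (Real.log (p l ω) - Real.log (p k ω)) ∂μ := by
    intro l
    split_ifs with hlk
    · subst hlk
      refine le_trans ?_ (h0 l)
      have : 0 ≤ L * (μ {ω ∈ J l | ∃ k', k' ≠ l ∧ p l ω < Real.exp L * p k' ω}).toReal := by
        positivity
      linarith
    · set B := {ω ∈ J l | ∃ k', k' ≠ l ∧ p l ω < Real.exp L * p k' ω} with hB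
      have hBJ : B ⊆ J l := fun ω h => h.1
      have hd : (μ (J l \ B)).toReal = (μ (J l)).toReal - (μ B).toReal := by
        have := measureReal_sdiff (μ := μ) hBJ (hBm l)
        simpa [Measure.real] using this
      have hge : ∫ ω in J l \ B, L ∂μ
          ≤ ∫ ω in J l \ B, (Real.log (p l ω) - Real.log (p k ω)) ∂μ := by
        refine setIntegral_mono_on (integrable_const _) (hdiff l).integrableOn
          ((hJm l).diff (hBm l)) ?_
        rintro ω ⟨hω, hωB⟩
        have hle : Real.exp L * p k ω ≤ p l ω := by
          by_contra hcon
          exact hωB ⟨hω, k, fun h => hlk h.symm, not_le.1 hcon⟩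
        have := Real.log_le_log (mul_pos (Real.exp_pos L) (hpos k ω)) hle
        rw [Real.log_mul (Real.exp_pos L).ne' (hpos k ω).ne', Real.log_exp] at this
        linarith
      have hmono : ∫ ω in J l \ B, (Real.log (p l ω) - Real.log (p k ω)) ∂μ
          ≤ ∫ ω in J l, (Real.log (p l ω) - Real.log (p k ω)) ∂μ := by
        refine setIntegral_mono_set (hdiff l).integrableOn ?_
          (Filter.Eventually.of_forall fun ω h => h.1)
        exact (ae_restrict_iff' (hJm l)).2 (Filter.Eventually.of_forall (hnn l))
      have hc : ∫ ω in J l \ B, L ∂μ = L * (μ (J l \ B)).toReal := by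
        simp [Measure.real, mul_comm]
      rw [← hd]
      linarith
  have hmain : (∑ l, ∫ ω in J l, Real.log ((μ (J l)).toReal * p l ω) ∂μ)
        - (∫ ω, Real.log (p k ω) ∂μ) = (∑ l, (μ (J l)).toReal * Real.log ((μ (J l)).toReal))
        + ∑ l, ∫ ω in J l, (Real.log (p l ω) - Real.log (p k ω)) ∂μ := by
    rw [hsplit _ (hint k), ← Finset.sum_sub_distrib, ← Finset.sum_add_distrib]
    refine Finset.sum_congr rfl fun l _ => ?_
    rw [hlog, integral_sub (hint l).integrableOn (hint k).integrableOn]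
    ring
  have hρk : (μ (J k)).toReal ≤ ρ := by
    rw [hρ]
    exact Finset.le_sup' (fun k => (μ (J k)).toReal) (Finset.mem_univ k)
  rw [hmain, ge_iff_le]
  refine add_le_add le_rfl ?_
  rcases max_choice 0 (1 - ρ - ε) with h | h
  · rw [h, mul_zero]
    exact Finset.sum_nonneg fun l _ => h0 l
  · rw [h]
    refine le_trans ?_ (Finset.sum_le_sum fun l _ => h1 l)
    rw [Finset.sum_sub_distrib, ← Finset.mul_sum, Finset.sum_sub_distrib, hsum,
      Finset.sum_ite_eq' Finset.univ k, if_pos (Finset.mem_univ k), ← mul_sub]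
    exact mul_le_mul_of_nonneg_left (by linarith) hL.le
end

section
/- Under (L,ε)-local separability, suppose μ(J_l) > 0 for every l, let ρ = max_l μ(J_l), and let w* ∈ S_K maximize elpd over S_K. Then the utility gain of stacking over single-model selection is lower-bounded: elpd(w*) − max_k ∫_Ω log p_k dμ ≥ max( ∑_{l=1}^K μ(J_l) log μ(J_l) + L·max(0, 1−ρ−ε) − ( ∑_{l=1}^K (1−μ(J_l))/μ(J_l) )·(ε + e^{−L}), 0 ). -/
open MeasureTheory Real

/-- Under (L,ε)-local separability, if every winning region has
positive probability, `ρ = max_l μ(J_l)`, and `w` maximizes `elpd` over the simplex,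
then the utility gain of stacking over single-model selection is lower-bounded:
`elpd(w) − max_k ∫ log p_k dμ ≥
  max( ∑_l μ(J_l) log μ(J_l) + L·max(0, 1−ρ−ε) − (∑_l (1−μ(J_l))/μ(J_l))·(ε + e^{−L}), 0 )`. -/
theorem hierarchical_stacking_stmt8
    {Ω : Type*} [MeasurableSpace Ω] (μ : Measure Ω) [IsProbabilityMeasure μ]
    (K : ℕ) (hK : 2 ≤ K)
    (p : Fin K → Ω → ℝ)
    (hmeas : ∀ k, Measurable (p k))
    (hpos : ∀ k ω, 0 < p k ω)
    (hint : ∀ k, Integrable (fun ω => Real.log (p k ω)) μ)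
    (J : Fin K → Set Ω)
    (hJ : ∀ k, J k = {ω | (∀ k', p k' ω ≤ p k ω) ∧ ∀ k' < k, p k' ω < p k ω})
    (L ε : ℝ) (hL : 0 < L) (hε0 : 0 ≤ ε) (hε1 : ε < 1)
    (hsep : ∑ k, (μ {ω ∈ J k | ∃ k', k' ≠ k ∧ p k ω < Real.exp L * p k' ω}).toReal ≤ ε)
    (hJpos : ∀ k, 0 < (μ (J k)).toReal)
    (ρ : ℝ)
    (hρ : ρ = Finset.univ.sup' ⟨(⟨0, by omega⟩ : Fin K), Finset.mem_univ _⟩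
      fun k => (μ (J k)).toReal)
    (w : Fin K → ℝ) (hw0 : ∀ k, 0 ≤ w k) (hw1 : ∑ k, w k = 1)
    (hmaxw : ∀ v : Fin K → ℝ, (∀ k, 0 ≤ v k) → ∑ k, v k = 1 →
      ∫ ω, Real.log (∑ k, v k * p k ω) ∂μ ≤ ∫ ω, Real.log (∑ k, w k * p k ω) ∂μ) :
    (∫ ω, Real.log (∑ k, w k * p k ω) ∂μ)
        - (Finset.univ.sup' ⟨(⟨0, by omega⟩ : Fin K), Finset.mem_univ _⟩
            fun k => ∫ ω, Real.log (p k ω) ∂μ)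
      ≥ max
          ((∑ l, (μ (J l)).toReal * Real.log ((μ (J l)).toReal))
            + L * max 0 (1 - ρ - ε)
            - (∑ l, (1 - (μ (J l)).toReal) / (μ (J l)).toReal) * (ε + Real.exp (-L)))
          0 := by
  classical
  have hJm : ∀ k, MeasurableSet (J k) := by
    intro k
    rw [hJ k]
    refine MeasurableSet.inter ?_ ?_
    · change MeasurableSet {ω | ∀ k', p k' ω ≤ p k ω}
      rw [show {ω | ∀ k', p k' ω ≤ p k ω} = ⋂ k', {ω | p k' ω ≤ p k ω} by ext; simp]
      exact MeasurableSet.iInter fun k' => measurableSet_le (hmeas k') (hmeas k)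
    · change MeasurableSet {ω | ∀ k' < k, p k' ω < p k ω}
      rw [show {ω | ∀ k' < k, p k' ω < p k ω} = ⋂ k', ⋂ (_ : k' < k), {ω | p k' ω < p k ω} by
        ext; simp]
      exact MeasurableSet.iInter fun k' => MeasurableSet.iInter fun _ =>
        measurableSet_lt (hmeas k') (hmeas k)
  have hdisj : ∀ k l ω, ω ∈ J k → ω ∈ J l → k = l := by
    intro k l ω hk hl
    rw [hJ] at hk hl
    rcases lt_trichotomy k l with h | h | h
    · exact absurd (hl.2 k h) (not_lt.mpr (hk.1 l))
    · exact h
    · exact absurd (hk.2 l h) (not_lt.mpr (hl.1 k))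
  have hne : (Finset.univ : Finset (Fin K)).Nonempty := ⟨⟨0, by omega⟩, Finset.mem_univ _⟩
  have hcov : ∀ ω, ∃ k, ω ∈ J k := by
    intro ω
    obtain ⟨k0, -, hk0⟩ := Finset.exists_max_image Finset.univ (fun k => p k ω) hne
    have hS : (Finset.univ.filter fun k => ∀ k', p k' ω ≤ p k ω).Nonempty :=
      ⟨k0, by simpa using hk0⟩
    obtain ⟨k, hk, hkm⟩ := Finset.exists_min_image _ id hS
    refine ⟨k, ?_⟩
    rw [hJ]
    simp only [Finset.mem_filter, Finset.mem_univ, true_and, id] at hk hkm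
    refine ⟨hk, fun k' hk' => ?_⟩
    by_contra hcon
    push Not at hcon
    exact absurd (hkm k' fun j => (hk j).trans hcon) (not_le.mpr hk')
  set m : Fin K → ℝ := fun k => (μ (J k)).toReal with hm
  have hm1 : ∑ k, m k = 1 := by
    have h1 : μ (⋃ k, J k) = ∑ k, μ (J k) := by
      rw [measure_iUnion _ hJm, tsum_fintype]
      intro k l hkl
      exact Set.disjoint_left.mpr fun ω h1 h2 => hkl (hdisj k l ω h1 h2)
    have h2 : (⋃ k, J k) = Set.univ := by
      ext ω; simpa using hcov ω
    rw [h2, measure_univ] at h1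
    rw [hm, ← ENNReal.toReal_sum fun _ _ => measure_ne_top _ _, ← h1]
    simp
  have hmle : ∀ k, m k ≤ 1 := fun k => by
    rw [← hm1]; exact Finset.single_le_sum (fun i _ => (hJpos i).le) (Finset.mem_univ k)
  have hsumge : ∀ l ω, m l * p l ω ≤ ∑ j, m j * p j ω := fun l ω =>
    Finset.single_le_sum (f := fun j => m j * p j ω)
      (fun i _ => mul_nonneg (hJpos i).le (hpos i ω).le) (Finset.mem_univ l)
  have hsumpos : ∀ ω, 0 < ∑ j, m j * p j ω := fun ω =>
    lt_of_lt_of_le (mul_pos (hJpos ⟨0, by omega⟩) (hpos _ ω)) (hsumge ⟨0, by omega⟩ ω)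
  have hFint : Integrable (fun ω => Real.log (∑ j, m j * p j ω)) μ := by
    have hS : Integrable (fun ω => ∑ j, |Real.log (p j ω)|) μ :=
      integrable_finsetSum _ fun j _ => (hint j).abs
    refine hS.mono' ?_ ?_
    · exact (Real.measurable_log.comp (Finset.measurable_sum _ fun j _ =>
        (hmeas j).const_mul (m j))).aestronglyMeasurable
    · refine Filter.Eventually.of_forall fun ω => ?_
      have hb : ∀ j, |Real.log (p j ω)| ≤ ∑ j, |Real.log (p j ω)| := fun j =>
        Finset.single_le_sum (f := fun j => |Real.log (p j ω)|)
          (fun i _ => abs_nonneg _) (Finset.mem_univ j)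
      set S := ∑ j, |Real.log (p j ω)|
      rw [Real.norm_eq_abs, abs_le]
      constructor
      · rw [Real.le_log_iff_exp_le (hsumpos ω)]
        calc Real.exp (-S) = ∑ j, m j * Real.exp (-S) := by rw [← Finset.sum_mul, hm1, one_mul]
          _ ≤ _ := by
            refine Finset.sum_le_sum fun j _ => mul_le_mul_of_nonneg_left ?_ (hJpos j).le
            rw [← Real.le_log_iff_exp_le (hpos j ω)]
            exact (abs_le.mp (hb j)).1
      · rw [Real.log_le_iff_le_exp (hsumpos ω)]
        calc _ ≤ ∑ j, m j * Real.exp S := by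
              refine Finset.sum_le_sum fun j _ => mul_le_mul_of_nonneg_left ?_ (hJpos j).le
              rw [← Real.log_le_iff_le_exp (hpos j ω)]
              exact (abs_le.mp (hb j)).2
          _ = _ := by rw [← Finset.sum_mul, hm1, one_mul]
  set B : Fin K → Set Ω := fun k => {ω ∈ J k | ∃ k', k' ≠ k ∧ p k ω < Real.exp L * p k' ω} with hB
  have hBm : ∀ k, MeasurableSet (B k) := by
    intro k
    refine (hJm k).inter ?_
    change MeasurableSet {ω | ∃ k', k' ≠ k ∧ p k ω < Real.exp L * p k' ω}
    rw [show {ω | ∃ k', k' ≠ k ∧ p k ω < Real.exp L * p k' ω}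
      = ⋃ k', ⋃ (_ : k' ≠ k), {ω | p k ω < Real.exp L * p k' ω} by ext; simp]
    exact MeasurableSet.iUnion fun k' => MeasurableSet.iUnion fun _ =>
      measurableSet_lt (hmeas k) ((hmeas k').const_mul _)
  have key : ∀ k c, 0 ≤ c → c ≤ L →
      (∑ l, m l * Real.log (m l)) + c * (1 - m k - ε)
        ≤ (∫ ω, Real.log (∑ j, m j * p j ω) ∂μ) - ∫ ω, Real.log (p k ω) ∂μ := by
    intro k c hc0 hcL
    set A : Set Ω := (J k ∪ ⋃ l, B l) with hA
    have hAm : MeasurableSet A := (hJm k).union (MeasurableSet.iUnion hBm)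
    have hAmeas : 1 - m k - ε ≤ μ.real Aᶜ := by
      rw [probReal_compl_eq_one_sub hAm]
      have h1 : μ.real A ≤ μ.real (J k) + μ.real (⋃ l, B l) := measureReal_union_le _ _
      have h2 : μ.real (⋃ l, B l) ≤ ∑ l, μ.real (B l) := measureReal_iUnion_fintype_le _
      have h3 : ∑ l, μ.real (B l) ≤ ε := hsep
      have h4 : μ.real (J k) = m k := rfl
      linarith
    have hi1 : ∀ l, Integrable ((J l).indicator fun _ => Real.log (m l)) μ := fun l =>
      (integrable_const _).indicator (hJm l)
    have hi2 : Integrable (Aᶜ.indicator fun _ => c) μ := (integrable_const _).indicator hAm.compl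
    rw [← integral_sub hFint (hint k)]
    have hI : ∫ ω, ((∑ l, (J l).indicator (fun _ => Real.log (m l)) ω)
        + Aᶜ.indicator (fun _ => c) ω) ∂μ = (∑ l, m l * Real.log (m l)) + μ.real Aᶜ * c := by
      rw [integral_add (integrable_finsetSum _ fun l _ => hi1 l) hi2,
        integral_finsetSum _ fun l _ => hi1 l, integral_indicator_const _ hAm.compl]
      simp only [integral_indicator_const _ (hJm _), smul_eq_mul]
      rfl
    calc _ ≤ (∑ l, m l * Real.log (m l)) + μ.real Aᶜ * c := by
          nlinarith [mul_le_mul_of_nonneg_left hAmeas hc0]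
      _ = _ := hI.symm
      _ ≤ _ := by
        refine integral_mono ((integrable_finsetSum _ fun l _ => hi1 l).add hi2)
          (hFint.sub (hint k)) fun ω => ?_
        obtain ⟨l, hl⟩ := hcov ω
        have hs : ∑ l, (J l).indicator (fun _ => Real.log (m l)) ω = Real.log (m l) := by
          rw [Finset.sum_eq_single l]
          · simp [hl]
          · intro j _ hj
            exact Set.indicator_of_notMem (fun h => hj (hdisj j l ω h hl)) _
          · simp
        have hlog : Real.log (m l) + Real.log (p l ω) ≤ Real.log (∑ j, m j * p j ω) := by
          rw [← Real.log_mul (hJpos l).ne' (hpos l ω).ne']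
          exact Real.log_le_log (mul_pos (hJpos l) (hpos l ω)) (hsumge l ω)
        have hrest : Aᶜ.indicator (fun _ => c) ω ≤ Real.log (p l ω) - Real.log (p k ω) := by
          by_cases hω : ω ∈ Aᶜ
          · rw [Set.indicator_of_mem hω]
            have hk : ω ∉ J k := fun h => hω (Or.inl h)
            have hkl : k ≠ l := fun h => hk (h ▸ hl)
            have hb : ω ∉ B l := fun h => hω (Or.inr (Set.mem_iUnion.mpr ⟨l, h⟩))
            have hge : Real.exp L * p k ω ≤ p l ω := by
              by_contra hcon
              exact hb ⟨hl, k, hkl, not_le.mp hcon⟩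
            have := Real.log_le_log (mul_pos (Real.exp_pos L) (hpos k ω)) hge
            rw [Real.log_mul (Real.exp_pos L).ne' (hpos k ω).ne', Real.log_exp] at this
            linarith
          · rw [Set.indicator_of_notMem hω]
            have h := hl
            rw [hJ] at h
            have := Real.log_le_log (hpos k ω) (h.1 k)
            linarith
        simp only [hs]
        linarith
  have hw_m := hmaxw m (fun k => (hJpos k).le) hm1
  obtain ⟨k, -, hk⟩ := Finset.exists_mem_eq_sup' hne (fun k => ∫ ω, Real.log (p k ω) ∂μ)
  rw [hk, ge_iff_le, max_le_iff]
  constructor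
  · have hmρ : m k ≤ ρ := by
      rw [hρ]; exact Finset.le_sup' m (Finset.mem_univ k)
    have hC : 0 ≤ (∑ l, (1 - m l) / m l) * (ε + Real.exp (-L)) :=
      mul_nonneg (Finset.sum_nonneg fun l _ => div_nonneg (by linarith [hmle l]) (hJpos l).le)
        (by positivity)
    have h0 := key k 0 le_rfl hL.le
    have h1 := key k L hL.le le_rfl
    have h2 : L * (1 - ρ - ε) ≤ L * (1 - m k - ε) :=
      mul_le_mul_of_nonneg_left (by linarith) hL.le
    rcases max_cases 0 (1 - ρ - ε) with ⟨h, -⟩ | ⟨h, -⟩ <;> rw [h] <;> linarith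
  · have := hmaxw (Pi.single k 1) (fun j => by
      by_cases h : j = k
      · subst h; simp
      · simp [h]) (by simp)
    simp [Pi.single_apply] at this
    linarith
end

section
/- Suppose μ(J_k) > 0 for every k and define the pointwise-selection expected log predictive density elpd_ps = ∑_{k=1}^K ∫_{J_k} log p_k dμ. Then elpd_ps − elpd_s(w^approx) = −∑_{k=1}^K μ(J_k) log μ(J_k), and this quantity is bounded below by −log( max_k μ(J_k) ). -/
open MeasureTheory Real

/-- If every winning region has positive probability, then with the
pointwise-selection expected log predictive density `elpd_ps = ∑_k ∫_{J_k} log p_k dμ`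
and the surrogate at `w^approx` (whose `k`-th entry is `μ(J_k)`),
`elpd_ps − elpd_s(w^approx) = −∑_k μ(J_k) log μ(J_k) ≥ −log(max_k μ(J_k))`. -/
theorem hierarchical_stacking_stmt9
    {Ω : Type*} [MeasurableSpace Ω] (μ : Measure Ω) [IsProbabilityMeasure μ]
    (K : ℕ) (hK : 2 ≤ K)
    (p : Fin K → Ω → ℝ)
    (hmeas : ∀ k, Measurable (p k))
    (hpos : ∀ k ω, 0 < p k ω)
    (hint : ∀ k, Integrable (fun ω => Real.log (p k ω)) μ)
    (J : Fin K → Set Ω)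
    (hJ : ∀ k, J k = {ω | (∀ k', p k' ω ≤ p k ω) ∧ ∀ k' < k, p k' ω < p k ω})
    (hJpos : ∀ k, 0 < (μ (J k)).toReal) :
    (∑ k, ∫ ω in J k, Real.log (p k ω) ∂μ)
        - (∑ k, ∫ ω in J k, Real.log ((μ (J k)).toReal * p k ω) ∂μ)
      = -∑ k, (μ (J k)).toReal * Real.log ((μ (J k)).toReal) ∧
    -Real.log (Finset.univ.sup' ⟨(⟨0, by omega⟩ : Fin K), Finset.mem_univ _⟩
        fun k => (μ (J k)).toReal)
      ≤ -∑ k, (μ (J k)).toReal * Real.log ((μ (J k)).toReal) := by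
  constructor
  · rw [← Finset.sum_sub_distrib, ← Finset.sum_neg_distrib]
    refine Finset.sum_congr rfl fun k _ => ?_
    have h : ∀ ω, Real.log ((μ (J k)).toReal * p k ω)
        = Real.log ((μ (J k)).toReal) + Real.log (p k ω) := fun ω =>
      Real.log_mul (hJpos k).ne' (hpos k ω).ne'
    simp_rw [h]
    rw [integral_add (integrable_const _) (hint k).integrableOn, setIntegral_const]
    simp only [smul_eq_mul, Measure.real]
    ring
  · have hcover : (⋃ k, J k) = Set.univ := by
      refine Set.eq_univ_of_forall fun ω => ?_
      have hne : (Finset.univ : Finset (Fin K)).Nonempty :=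
        ⟨(⟨0, by omega⟩ : Fin K), Finset.mem_univ _⟩
      obtain ⟨m, -, hm⟩ := Finset.exists_max_image Finset.univ (fun k => p k ω) hne
      obtain ⟨k, hk, hk'⟩ := Finset.exists_min_image
        (Finset.univ.filter fun k => ∀ k', p k' ω ≤ p k ω) id
        ⟨m, by simpa using hm⟩
      simp only [Finset.mem_filter, Finset.mem_univ, true_and, id] at hk hk'
      refine Set.mem_iUnion.2 ⟨k, ?_⟩
      rw [hJ]
      refine ⟨hk, fun j hj => lt_of_not_ge fun hge => ?_⟩
      exact absurd (hk' j fun i => (hk i).trans hge) (not_le.2 hj)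
    have hsum : 1 ≤ ∑ k, (μ (J k)).toReal := by
      have h := measureReal_iUnion_fintype_le (μ := μ) J
      rw [hcover] at h
      simpa [Measure.real] using h
    set M := Finset.univ.sup' ⟨(⟨0, by omega⟩ : Fin K), Finset.mem_univ _⟩
        fun k => (μ (J k)).toReal with hM
    have hle : ∀ k, (μ (J k)).toReal ≤ M := fun k =>
      Finset.le_sup' (fun k => (μ (J k)).toReal) (Finset.mem_univ k)
    have hM1 : M ≤ 1 := Finset.sup'_le _ _ fun k _ => measureReal_le_one
    have hM0 : 0 ≤ M := (hJpos ⟨0, by omega⟩).le.trans (hle _)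
    have hlog : Real.log M ≤ 0 := Real.log_nonpos hM0 hM1
    have h1 : ∑ k, (μ (J k)).toReal * Real.log ((μ (J k)).toReal)
        ≤ (∑ k, (μ (J k)).toReal) * Real.log M := by
      rw [Finset.sum_mul]
      exact Finset.sum_le_sum fun k _ =>
        mul_le_mul_of_nonneg_left (Real.log_le_log (hJpos k) (hle k)) (hJpos k).le
    nlinarith
end

section
/- Under (L,ε)-local separability, suppose μ(J_k) > 0 for every k and let ρ = max_k μ(J_k). Define the pointwise-selection expected log predictive density elpd_ps = ∑_{k=1}^K ∫_{J_k} log p_k dμ. Then for every w ∈ S_K with w_k > 0 for all k (in particular for any maximizer of elpd with positive entries), elpd_ps − elpd(w) ≥ −log ρ − ( ∑_{k=1}^K (1−w_k)/w_k )·(ε + e^{−L}); that is, pointwise model selection gains at least −log ρ over complete-pooling stacking up to an O(ε + e^{−L}) term. -/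
open MeasureTheory Real

/-- Under (L,ε)-local separability, if every winning region has
positive probability and `ρ = max_k μ(J_k)`, then with the pointwise-selection expected
log predictive density `elpd_ps = ∑_k ∫_{J_k} log p_k dμ`, for every `w` in the simplex
with all entries positive,
`elpd_ps − elpd(w) ≥ −log ρ − (∑_k (1−w_k)/w_k)·(ε + e^{−L})`. -/
theorem hierarchical_stacking_stmt10
    {Ω : Type*} [MeasurableSpace Ω] (μ : Measure Ω) [IsProbabilityMeasure μ]
    (K : ℕ) (hK : 2 ≤ K)
    (p : Fin K → Ω → ℝ)
    (hmeas : ∀ k, Measurable (p k))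
    (hpos : ∀ k ω, 0 < p k ω)
    (hint : ∀ k, Integrable (fun ω => Real.log (p k ω)) μ)
    (J : Fin K → Set Ω)
    (hJ : ∀ k, J k = {ω | (∀ k', p k' ω ≤ p k ω) ∧ ∀ k' < k, p k' ω < p k ω})
    (L ε : ℝ) (hL : 0 < L) (hε0 : 0 ≤ ε) (hε1 : ε < 1)
    (hsep : ∑ k, (μ {ω ∈ J k | ∃ k', k' ≠ k ∧ p k ω < Real.exp L * p k' ω}).toReal ≤ ε)
    (hJpos : ∀ k, 0 < (μ (J k)).toReal)
    (ρ : ℝ)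
    (hρ : ρ = Finset.univ.sup' ⟨(⟨0, by omega⟩ : Fin K), Finset.mem_univ _⟩
      fun k => (μ (J k)).toReal)
    (w : Fin K → ℝ) (hw0 : ∀ k, 0 < w k) (hw1 : ∑ k, w k = 1) :
    (∑ k, ∫ ω in J k, Real.log (p k ω) ∂μ)
        - (∫ ω, Real.log (∑ k, w k * p k ω) ∂μ)
      ≥ -Real.log ρ - (∑ k, (1 - w k) / w k) * (ε + Real.exp (-L)) := by
  have hK0 : 0 < K := by omega
  have : Nonempty (Fin K) := ⟨⟨0, hK0⟩⟩
  have hSpos : ∀ ω, 0 < ∑ k, w k * p k ω := fun ω =>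
    Finset.sum_pos (fun k _ => mul_pos (hw0 k) (hpos k ω)) Finset.univ_nonempty
  have hwle : ∀ k, w k ≤ 1 := fun k => by
    rw [← hw1]
    exact Finset.single_le_sum (fun i _ => (hw0 i).le) (Finset.mem_univ k)
  have hc : ∀ k, 0 ≤ (1 - w k) / w k := fun k =>
    div_nonneg (by linarith [hwle k]) (hw0 k).le
  have hJm : ∀ k, MeasurableSet (J k) := fun k => by
    rw [hJ k]
    refine MeasurableSet.inter ?_ ?_
    · have : {ω | ∀ k', p k' ω ≤ p k ω} = ⋂ k', {ω | p k' ω ≤ p k ω} := by ext; simp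
      refine Eq.subst (motive := fun s => MeasurableSet s) this.symm ?_; exact MeasurableSet.iInter fun k' => measurableSet_le (hmeas k') (hmeas k)
    · have : {ω | ∀ k' < k, p k' ω < p k ω} = ⋂ k', ⋂ (_ : k' < k), {ω | p k' ω < p k ω} := by
        ext; simp
      refine Eq.subst (motive := fun s => MeasurableSet s) this.symm ?_; exact MeasurableSet.iInter fun k' => MeasurableSet.iInter fun _ =>
        measurableSet_lt (hmeas k') (hmeas k)
  set B : Fin K → Set Ω :=
    fun k => {ω ∈ J k | ∃ k', k' ≠ k ∧ p k ω < Real.exp L * p k' ω} with hB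
  have hBm : ∀ k, MeasurableSet (B k) := fun k => by
    refine (hJm k).inter ?_
    have : {ω | ∃ k', k' ≠ k ∧ p k ω < Real.exp L * p k' ω}
        = ⋃ k', ⋃ (_ : k' ≠ k), {ω | p k ω < Real.exp L * p k' ω} := by ext; simp
    refine Eq.subst (motive := fun s => MeasurableSet s) this.symm ?_; exact MeasurableSet.iUnion fun k' => MeasurableSet.iUnion fun _ =>
        measurableSet_lt (hmeas k) ((hmeas k').const_mul _)
  have hdisj : Pairwise (Function.onFun Disjoint J) := by
    intro a b hab
    rw [Function.onFun, Set.disjoint_left]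
    intro ω ha hb
    rw [hJ] at ha hb
    rcases lt_or_gt_of_ne hab with h | h
    · exact absurd (hb.2 a h) (not_lt.mpr (ha.1 b))
    · exact absurd (ha.2 b h) (not_lt.mpr (hb.1 a))
  have hcov : (⋃ k, J k) = Set.univ := by
    rw [Set.eq_univ_iff_forall]
    intro ω
    obtain ⟨k0, hk0⟩ := Finite.exists_max (fun k => p k ω)
    obtain ⟨k, hk, hkmin⟩ := WellFounded.has_min (wellFounded_lt (α := Fin K))
      {k | ∀ j, p j ω ≤ p k ω} ⟨k0, hk0⟩
    refine Set.mem_iUnion.mpr ⟨k, ?_⟩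
    rw [hJ k]
    refine ⟨hk, fun j hj => lt_of_not_ge fun hge => hkmin j (fun i => (hk i).trans hge) hj⟩
  have hSm : Measurable fun ω => ∑ k, w k * p k ω :=
    Finset.measurable_sum _ fun k _ => (hmeas k).const_mul _
  have hSle : ∀ ω k, (∀ j, p j ω ≤ p k ω) → ∑ j, w j * p j ω ≤ p k ω := fun ω k h => by
    calc ∑ j, w j * p j ω ≤ ∑ j, w j * p k ω :=
          Finset.sum_le_sum fun j _ => mul_le_mul_of_nonneg_left (h j) (hw0 j).le
      _ = p k ω := by rw [← Finset.sum_mul, hw1, one_mul]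
  have hSge : ∀ ω k, (∀ j, p k ω ≤ p j ω) → p k ω ≤ ∑ j, w j * p j ω := fun ω k h => by
    calc p k ω = ∑ j, w j * p k ω := by rw [← Finset.sum_mul, hw1, one_mul]
      _ ≤ _ := Finset.sum_le_sum fun j _ => mul_le_mul_of_nonneg_left (h j) (hw0 j).le
  have hSint : Integrable (fun ω => Real.log (∑ k, w k * p k ω)) μ := by
    refine Integrable.mono' (integrable_finsetSum Finset.univ fun k _ => (hint k).abs)
      (Real.measurable_log.comp hSm).aestronglyMeasurable (Filter.Eventually.of_forall fun ω => ?_)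
    have hs : ∀ k, |Real.log (p k ω)| ≤ ∑ k, |Real.log (p k ω)| := fun k =>
      Finset.single_le_sum (f := fun k => |Real.log (p k ω)|)
        (fun i _ => abs_nonneg _) (Finset.mem_univ k)
    obtain ⟨a, ha⟩ := Finite.exists_max (fun k => p k ω)
    obtain ⟨b, hb⟩ := Finite.exists_min (fun k => p k ω)
    have h1 := Real.log_le_log (hSpos ω) (hSle ω a ha)
    have h2 := Real.log_le_log (hpos b ω) (hSge ω b hb)
    rw [Real.norm_eq_abs, abs_le]
    constructor
    · linarith [hs b, neg_abs_le (Real.log (p b ω))]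
    · linarith [hs a, le_abs_self (Real.log (p a ω))]
  -- pointwise bound
  have hpt : ∀ k, ∀ ω ∈ J k, Real.log (∑ j, w j * p j ω) ≤
      Real.log (p k ω) + (Real.log (w k) + (1 - w k) / w k * Real.exp (-L))
        + (B k).indicator (fun _ => (1 - w k) / w k) ω := by
    intro k ω hω
    have hω' := hω
    rw [hJ k] at hω'
    have he : 0 < Real.exp (-L) := Real.exp_pos _
    by_cases hb : ω ∈ B k
    · rw [Set.indicator_of_mem hb]
      have h1 := Real.log_le_log (hSpos ω) (hSle ω k hω'.1)
      have h2 := Real.one_sub_inv_le_log_of_pos (hw0 k)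
      have h3 : (1 - w k) / w k = (w k)⁻¹ - 1 := by
        have := (hw0 k).ne'
        field_simp
      have h4 := mul_nonneg (hc k) he.le
      linarith
    · rw [Set.indicator_of_notMem hb]
      have hg : ∀ j, j ≠ k → p j ω ≤ Real.exp (-L) * p k ω := by
        intro j hj
        have : Real.exp L * p j ω ≤ p k ω := by
          by_contra hcon
          exact hb ⟨hω, j, hj, not_le.mp hcon⟩
        calc p j ω = Real.exp (-L) * (Real.exp L * p j ω) := by
              rw [← mul_assoc, ← Real.exp_add]; simp
          _ ≤ _ := mul_le_mul_of_nonneg_left this he.le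
      have hsum : ∑ j, w j * p j ω ≤ p k ω * (w k * (1 + (1 - w k) / w k * Real.exp (-L))) := by
        have hw1' := hw1
        rw [← Finset.add_sum_erase _ _ (Finset.mem_univ k)] at hw1' ⊢
        have : ∑ j ∈ Finset.univ.erase k, w j * p j ω
            ≤ ∑ j ∈ Finset.univ.erase k, w j * (Real.exp (-L) * p k ω) :=
          Finset.sum_le_sum fun j hj =>
            mul_le_mul_of_nonneg_left (hg j (Finset.ne_of_mem_erase hj)) (hw0 j).le
        rw [← Finset.sum_mul] at this
        have h5 : ∑ j ∈ Finset.univ.erase k, w j = 1 - w k := by linarith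
        rw [h5] at this
        have h6 : p k ω * (w k * (1 + (1 - w k) / w k * Real.exp (-L)))
            = w k * p k ω + (1 - w k) * (Real.exp (-L) * p k ω) := by
          have := (hw0 k).ne'
          field_simp
        linarith
      have h4 := mul_nonneg (hc k) he.le
      have hx : 0 < 1 + (1 - w k) / w k * Real.exp (-L) := by linarith
      have h1 := Real.log_le_log (hSpos ω) hsum
      rw [Real.log_mul (hpos k ω).ne' (mul_pos (hw0 k) hx).ne',
        Real.log_mul (hw0 k).ne' hx.ne'] at h1
      have := Real.log_le_sub_one_of_pos hx
      linarith
  have hk : ∀ k, ∫ ω in J k, Real.log (∑ j, w j * p j ω) ∂μ ≤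
      ∫ ω in J k, Real.log (p k ω) ∂μ
      + (μ (J k)).toReal * (Real.log (w k) + (1 - w k) / w k * Real.exp (-L))
      + (μ (B k)).toReal * ((1 - w k) / w k) := by
    intro k
    have i1 : Integrable (fun ω => Real.log (p k ω)) (μ.restrict (J k)) := (hint k).integrableOn
    have i2 : Integrable (fun _ : Ω => Real.log (w k) + (1 - w k) / w k * Real.exp (-L))
      (μ.restrict (J k)) := integrable_const _
    have i3 : Integrable ((B k).indicator (fun _ => (1 - w k) / w k)) (μ.restrict (J k)) :=
      (integrable_const _).indicator (hBm k)
    have h := setIntegral_mono_on (μ := μ) (s := J k) hSint.integrableOn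
      ((i1.add i2).add i3) (hJm k) (hpt k)
    refine h.trans (le_of_eq ?_)
    have e1 := integral_add (i1.add i2) i3
    have e2 := integral_add i1 i2
    have e3 : (B k) ∩ (J k) = B k := Set.inter_eq_left.mpr fun x hx => hx.1
    simp only [Pi.add_apply] at e1 e2 ⊢
    rw [e1, e2, integral_indicator_const _ (hBm k), measureReal_restrict_apply (hBm k), e3,
      setIntegral_const]
    simp [Measure.real]
  have htot : ∫ ω, Real.log (∑ j, w j * p j ω) ∂μ
      = ∑ k, ∫ ω in J k, Real.log (∑ j, w j * p j ω) ∂μ := by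
    rw [← integral_iUnion_fintype hJm hdisj (fun k => hSint.integrableOn), hcov,
      setIntegral_univ]
  have hone : ∑ k, (μ (J k)).toReal = 1 := by
    have := integral_iUnion_fintype (μ := μ) (f := fun _ => (1 : ℝ)) hJm hdisj
      (fun k => (integrable_const _).integrableOn)
    rw [hcov] at this
    simpa [Measure.real] using this.symm
  have hρle : ∀ k, (μ (J k)).toReal ≤ ρ := fun k => by
    rw [hρ]
    exact Finset.le_sup' (fun k => (μ (J k)).toReal) (Finset.mem_univ k)
  have hρpos : 0 < ρ := (hJpos ⟨0, hK0⟩).trans_le (hρle _)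
  have hent : ∑ k, (μ (J k)).toReal * Real.log (w k) ≤ Real.log ρ := by
    calc ∑ k, (μ (J k)).toReal * Real.log (w k)
        ≤ ∑ k, ((μ (J k)).toReal * (Real.log ρ - 1) + w k) := by
          refine Finset.sum_le_sum fun k _ => ?_
          have h1 := Real.log_le_sub_one_of_pos (div_pos (hw0 k) hρpos)
          rw [Real.log_div (hw0 k).ne' hρpos.ne'] at h1
          have h2 : (μ (J k)).toReal * (w k / ρ) ≤ w k := by
            calc (μ (J k)).toReal * (w k / ρ) ≤ ρ * (w k / ρ) :=
                  mul_le_mul_of_nonneg_right (hρle k) (div_pos (hw0 k) hρpos).le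
              _ = w k := by field_simp
          have h3 := mul_le_mul_of_nonneg_left h1 (hJpos k).le
          linarith
      _ = Real.log ρ := by
          rw [Finset.sum_add_distrib, ← Finset.sum_mul, hone, hw1]; ring
  have hJ1 : ∀ k, (μ (J k)).toReal ≤ 1 := fun k => by
    rw [← hone]
    exact Finset.single_le_sum (f := fun k => (μ (J k)).toReal)
      (fun i _ => (hJpos i).le) (Finset.mem_univ k)
  have hBε : ∀ k, (μ (B k)).toReal ≤ ε := fun k =>
    (Finset.single_le_sum (f := fun k => (μ (B k)).toReal)
      (fun i _ => ENNReal.toReal_nonneg) (Finset.mem_univ k)).trans hsep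
  have hfin : ∑ k, ∫ ω in J k, Real.log (∑ j, w j * p j ω) ∂μ ≤
      ∑ k, (∫ ω in J k, Real.log (p k ω) ∂μ + (μ (J k)).toReal * Real.log (w k)
        + (1 - w k) / w k * (ε + Real.exp (-L))) := by
    refine Finset.sum_le_sum fun k _ => (hk k).trans ?_
    have he := mul_nonneg (hc k) (Real.exp_pos (-L)).le
    have h1 := mul_le_mul_of_nonneg_right (hJ1 k) he
    have h2 := mul_le_mul_of_nonneg_right (hBε k) (hc k)
    linarith
  rw [Finset.sum_add_distrib, Finset.sum_add_distrib, ← Finset.sum_mul] at hfin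
  rw [htot]
  linarith
end

section
/- The expected log predictive density of the misspecified conditional model M₂ equals ∫₀¹ ( x · log(√x) + (1−x) · log(1−√x) ) dx = −7/12, and this exceeds log(1/2), the expected log predictive density of the true marginal model M₁. Hence the misspecified conditional prediction M₂ strictly outperforms the true marginal model M₁ in expected log score. -/
open Real intervalIntegral

/-- With data generated as `x ~ Uniform(0,1)` and
`y | x ~ Bernoulli(x)`, the expected log predictive density of the misspecified
conditional model `M₂` (predicting `Pr(y=1|x) = √x`) equals
`∫₀¹ (x log √x + (1−x) log(1−√x)) dx = −7/12`, which exceeds `log(1/2)`, the expected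
log predictive density of the true marginal model `M₁`. -/
theorem hierarchical_stacking_stmt11 :
    (∫ x in (0:ℝ)..1,
        (x * Real.log (Real.sqrt x) + (1 - x) * Real.log (1 - Real.sqrt x)))
      = -7 / 12 ∧
    Real.log (1 / 2) < -7 / 12 := by
  have cml : Continuous fun t : ℝ => t * Real.log t := Real.continuous_mul_log
  have cs : Continuous fun x : ℝ => 1 - Real.sqrt x := by fun_prop
  have ct : Continuous fun x : ℝ => (1 - Real.sqrt x) * Real.log (1 - Real.sqrt x) :=
    cml.comp cs
  constructor
  · have hint : IntervalIntegrable (fun x : ℝ =>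
        x * Real.log (Real.sqrt x) + (1 - x) * Real.log (1 - Real.sqrt x))
        MeasureTheory.volume 0 1 := by
      have hc : Continuous fun x : ℝ => (1 / 2) * (x * Real.log x) +
          (1 + Real.sqrt x) * ((1 - Real.sqrt x) * Real.log (1 - Real.sqrt x)) := by
        fun_prop
      apply ContinuousOn.intervalIntegrable
      apply hc.continuousOn.congr
      intro x hx
      rw [Set.uIcc_of_le zero_le_one] at hx
      have h := Real.sq_sqrt hx.1
      simp only
      rw [Real.log_sqrt hx.1]
      linear_combination (Real.log (1 - Real.sqrt x)) * h
    have key := integral_eq_sub_of_hasDerivAt_of_le (a := (0:ℝ)) (b := 1)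
      (f := fun x : ℝ => x / 4 * (x * Real.log x) - x ^ 2 / 8
        - ((2 * (1 - Real.sqrt x) - 2 * (1 - Real.sqrt x) ^ 2 + (1 - Real.sqrt x) ^ 3 / 2)
            * ((1 - Real.sqrt x) * Real.log (1 - Real.sqrt x))
          - (1 - Real.sqrt x) ^ 2 + 2 / 3 * (1 - Real.sqrt x) ^ 3
          - (1 - Real.sqrt x) ^ 4 / 8)) zero_le_one
      (by apply Continuous.continuousOn; fun_prop) ?_ hint
    · rw [key]
      norm_num
    · intro x hx
      have h := Real.sq_sqrt hx.1.le
      have hs : 0 < Real.sqrt x := Real.sqrt_pos.2 hx.1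
      have hs1 : Real.sqrt x < 1 := by
        rw [Real.sqrt_lt' one_pos]; simpa using hx.2
      have ht : 1 - Real.sqrt x ≠ 0 := by linarith
      have hx0 : x ≠ 0 := hx.1.ne'
      have d1 : HasDerivAt (fun x : ℝ => x * Real.log x) (Real.log x + 1) x :=
        Real.hasDerivAt_mul_log hx0
      have d2 : HasDerivAt (fun x : ℝ => 1 - Real.sqrt x) (-(1 / (2 * Real.sqrt x))) x :=
        (Real.hasDerivAt_sqrt hx0).const_sub 1
      have dH : HasDerivAt (fun t : ℝ => (2 * t - 2 * t ^ 2 + t ^ 3 / 2) * (t * Real.log t)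
          - t ^ 2 + 2 / 3 * t ^ 3 - t ^ 4 / 8)
          ((4 * (1 - Real.sqrt x) - 6 * (1 - Real.sqrt x) ^ 2 + 2 * (1 - Real.sqrt x) ^ 3)
            * Real.log (1 - Real.sqrt x)) (1 - Real.sqrt x) := by
        generalize 1 - Real.sqrt x = t at ht
        have i := hasDerivAt_id' t
        have e := (((((i.const_mul 2).sub ((i.pow 2).const_mul 2)).add
          ((i.pow 3).div_const 2)).mul (Real.hasDerivAt_mul_log ht)).sub (i.pow 2)).add
          ((i.pow 3).const_mul (2 / 3)) |>.sub ((i.pow 4).div_const 8)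
        refine e.congr_deriv ?_
        simp
        ring
      have dH2 := HasDerivAt.comp x dH d2
      have i := hasDerivAt_id' x
      have e := ((((i.div_const 4).mul d1).sub ((i.pow 2).div_const 8)).sub dH2)
      refine e.congr_deriv ?_
      rw [Real.log_sqrt hx.1.le]
      generalize Real.log (1 - Real.sqrt x) = L
      generalize Real.sqrt x = s at *
      subst h
      simp
      field_simp
      ring
  · have := Real.log_two_gt_d9
    rw [one_div, Real.log_inv]
    linarith
end

section
/- For every δ ∈ [1/3, 1/2), the population stacking objective φ_δ(w) attains its maximum over w ∈ [0,1] uniquely at w = 1; that is, complete-pooling stacking assigns weight zero to model 2 even though model 2 strictly outperforms model 1 on the region (0,1]. -/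
open Real

/-- The population stacking objective for the toy example: the expectation of
`log(w p₁(y) + (1−w) p₂(y))` under `y ~ Uniform(−3,1)`, where `p₁` has mass `1−δ` on
`[−4,0]` and `δ` on `(0,2]`, and `p₂` has mass `δ` on `[−4,0]` and `1−δ` on `(0,2]`. -/
noncomputable def toyStackingObjective (δ w : ℝ) : ℝ :=
  (3 / 4) * Real.log (w * ((1 - δ) / 4) + (1 - w) * (δ / 4))
    + (1 / 4) * Real.log (w * (δ / 2) + (1 - w) * ((1 - δ) / 2))

/-- For every `δ ∈ [1/3, 1/2)`, the population stacking objective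
`φ_δ(w)` attains its maximum over `w ∈ [0,1]` uniquely at `w = 1`: complete-pooling
stacking assigns weight zero to model 2 even though model 2 strictly outperforms
model 1 on the region `(0,1]`. -/
theorem hierarchical_stacking_stmt13
    (δ : ℝ) (hδ : δ ∈ Set.Ico (1 / 3 : ℝ) (1 / 2)) :
    (∀ w ∈ Set.Icc (0 : ℝ) 1, toyStackingObjective δ w ≤ toyStackingObjective δ 1) ∧
    (∀ w ∈ Set.Icc (0 : ℝ) 1, w ≠ 1 →
      toyStackingObjective δ w < toyStackingObjective δ 1) := by
  obtain ⟨h1, h2⟩ := hδ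
  have key : ∀ w ∈ Set.Icc (0 : ℝ) 1, w ≠ 1 →
      toyStackingObjective δ w < toyStackingObjective δ 1 := by
    rintro w ⟨hw0, hw1⟩ hne
    have hw : w < 1 := lt_of_le_of_ne hw1 hne
    have hd : 0 < δ := by linarith
    have hd' : 0 < 1 - δ := by linarith
    have ht : 0 < (1 - w) * (1 - 2 * δ) := mul_pos (by linarith) (by linarith)
    have hA : 0 < w * ((1 - δ) / 4) + (1 - w) * (δ / 4) := by nlinarith
    have hC : 0 < w * (δ / 2) + (1 - w) * ((1 - δ) / 2) := by nlinarith
    have hB : 0 < (1 - δ) / 4 := by linarith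
    have hD : 0 < δ / 2 := by linarith
    have e1 := Real.log_lt_sub_one_of_pos (div_pos hA hB) (by
      rw [Ne, div_eq_one_iff_eq hB.ne']
      intro h
      nlinarith)
    have e2 := Real.log_le_sub_one_of_pos (div_pos hC hD)
    rw [Real.log_div hA.ne' hB.ne'] at e1
    rw [Real.log_div hC.ne' hD.ne'] at e2
    have r1 : (w * ((1 - δ) / 4) + (1 - w) * (δ / 4)) / ((1 - δ) / 4) - 1
        = -((1 - w) * (1 - 2 * δ) / (1 - δ)) := by
      field_simp
      ring
    have r2 : (w * (δ / 2) + (1 - w) * ((1 - δ) / 2)) / (δ / 2) - 1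
        = (1 - w) * (1 - 2 * δ) / δ := by
      field_simp
      ring
    rw [r1] at e1
    rw [r2] at e2
    have r3 : (1 - w) * (1 - 2 * δ) / δ ≤ 3 * ((1 - w) * (1 - 2 * δ) / (1 - δ)) := by
      rw [← mul_div_assoc, div_le_div_iff₀ hd hd']
      nlinarith
    have r4 : toyStackingObjective δ 1
        = 3 / 4 * Real.log ((1 - δ) / 4) + 1 / 4 * Real.log (δ / 2) := by
      simp [toyStackingObjective]
    rw [r4, toyStackingObjective]
    linarith
  refine ⟨fun w hw => ?_, key⟩
  by_cases h : w = 1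
  · rw [h]
  · exact (key w hw h).le
end

section
/- For every δ ∈ (0, 1/4], the population stacking objective φ_δ(w) attains its maximum over w ∈ [0,1] uniquely at w = (3 − 4δ)/(4 − 8δ). In particular, for δ = 1/100 the optimal complete-pooling stacking weight of model 1 equals 37/49 ≈ 0.755, which is close to (but not exactly) the winning-region probability 3/4 of model 1 under the true data distribution. -/
open Real

/-- For every `δ ∈ (0, 1/4]`, the population stacking objective
`φ_δ(w)` attains its maximum over `w ∈ [0,1]` uniquely at `w = (3 − 4δ)/(4 − 8δ)`.
In particular, for `δ = 1/100` the optimal complete-pooling stacking weight of model 1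
equals `37/49 ≈ 0.755`, which is close to (but not exactly) the winning-region
probability `3/4` of model 1. -/
theorem hierarchical_stacking_stmt14
    (δ : ℝ) (hδ : δ ∈ Set.Ioc (0 : ℝ) (1 / 4)) :
    (∀ w ∈ Set.Icc (0 : ℝ) 1,
      toyStackingObjective δ w ≤ toyStackingObjective δ ((3 - 4 * δ) / (4 - 8 * δ))) ∧
    (∀ w ∈ Set.Icc (0 : ℝ) 1, w ≠ (3 - 4 * δ) / (4 - 8 * δ) →
      toyStackingObjective δ w < toyStackingObjective δ ((3 - 4 * δ) / (4 - 8 * δ))) ∧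
    (3 - 4 * (1 / 100 : ℝ)) / (4 - 8 * (1 / 100)) = 37 / 49 ∧
    (37 / 49 : ℝ) ≠ 3 / 4 := by
  have h0 := hδ.1
  have h1 := hδ.2
  have hd : (4 - 8 * δ) ≠ 0 := by linarith
  have key : ∀ w ∈ Set.Icc (0 : ℝ) 1, w ≠ (3 - 4 * δ) / (4 - 8 * δ) →
      toyStackingObjective δ w < toyStackingObjective δ ((3 - 4 * δ) / (4 - 8 * δ)) := by
    intro w hw hne
    obtain ⟨hw0, hw1⟩ := hw
    have hA : (3 - 4 * δ) / (4 - 8 * δ) * ((1 - δ) / 4)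
        + (1 - (3 - 4 * δ) / (4 - 8 * δ)) * (δ / 4) = 3 / 16 := by
      have hd' : (1 - 2 * δ) ≠ 0 := by linarith
      rw [div_mul_eq_mul_div, one_sub_div hd, div_mul_eq_mul_div, ← add_div, div_eq_iff hd]
      ring
    have hB : (3 - 4 * δ) / (4 - 8 * δ) * (δ / 2)
        + (1 - (3 - 4 * δ) / (4 - 8 * δ)) * ((1 - δ) / 2) = 1 / 8 := by
      rw [div_mul_eq_mul_div, one_sub_div hd, div_mul_eq_mul_div, ← add_div, div_eq_iff hd]
      ring
    unfold toyStackingObjective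
    rw [hA, hB]
    set p := w * ((1 - δ) / 4) + (1 - w) * (δ / 4) with hp
    set q := w * (δ / 2) + (1 - w) * ((1 - δ) / 2) with hq
    have hpq : 4 * p + 2 * q = 1 := by rw [hp, hq]; ring
    have hp0 : 0 < p := by rw [hp]; nlinarith
    have hq0 : 0 < q := by rw [hq]; nlinarith
    have hpne : p / (3 / 16) ≠ 1 := by
      intro h
      apply hne
      rw [div_eq_one_iff_eq (by norm_num)] at h
      rw [eq_div_iff hd]
      rw [hp] at h
      linarith
    have l1 := Real.log_lt_sub_one_of_pos (div_pos hp0 (by norm_num : (0 : ℝ) < 3 / 16)) hpne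
    have l2 := Real.log_le_sub_one_of_pos (div_pos hq0 (by norm_num : (0 : ℝ) < 1 / 8))
    rw [Real.log_div hp0.ne' (by norm_num)] at l1
    rw [Real.log_div hq0.ne' (by norm_num)] at l2
    linarith
  refine ⟨?_, key, by norm_num, by norm_num⟩
  intro w hw
  by_cases h : w = (3 - 4 * δ) / (4 - 8 * δ)
  · rw [← h]
  · exact (key w hw h).le
end
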